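/- Let T1 and T2 be two theories and A a formula such that σ_{T1 ∪ {A}} ∩ σ_{T2} = ∅. If T2 is a set of negative literals and T1 ∪ T2 ⊢_I A, then T1 ⊢_I A. -/

import Mathlib

namespace ASP

/-- Propositional formulas over atoms `α`, built with ∧, ∨, ← and ⊥.
`impl A B` denotes the formula `B ← A` (i.e. `A → B`). -/
inductive PropForm (α : Type) : Type
  | var : α → PropForm α
  | fals : PropForm α
  | conj : PropForm α → PropForm α → PropForm α
  | disj : PropForm α → PropForm α → PropForm α
  | impl : PropForm α → PropForm α → PropForm α
  deriving DecidableEq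

namespace PropForm

variable {α : Type}

/-- `¬F` abbreviates `⊥ ← F`. -/
def neg (A : PropForm α) : PropForm α := impl A fals

/-- `⊤` abbreviates `⊥ ← ⊥`. -/
def top : PropForm α := impl fals fals

/-- The set of atoms occurring in a formula. -/
def atoms : PropForm α → Set α
  | var a => {a}
  | fals => ∅
  | conj A B => atoms A ∪ atoms B
  | disj A B => atoms A ∪ atoms B
  | impl A B => atoms A ∪ atoms B

end PropForm

open PropForm

/-- Hilbert-style derivability for intuitionistic propositional logic,
with an extra set `Ax` of additional axioms. -/
inductive Deriv {α : Type} (Ax : Set (PropForm α)) : PropForm α → Prop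
  | ax {A} : A ∈ Ax → Deriv Ax A
  | k (A B) : Deriv Ax (impl A (impl B A))
  | s (A B C) : Deriv Ax (impl (impl A (impl B C)) (impl (impl A B) (impl A C)))
  | conjIntro (A B) : Deriv Ax (impl A (impl B (conj A B)))
  | conjElimL (A B) : Deriv Ax (impl (conj A B) A)
  | conjElimR (A B) : Deriv Ax (impl (conj A B) B)
  | disjIntroL (A B) : Deriv Ax (impl A (disj A B))
  | disjIntroR (A B) : Deriv Ax (impl B (disj A B))
  | disjElim (A B C) : Deriv Ax (impl (impl A C) (impl (impl B C) (impl (disj A B) C)))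
  | falsElim (A) : Deriv Ax (impl fals A)
  | mp {A B} : Deriv Ax (impl A B) → Deriv Ax A → Deriv Ax B

/-- `F` is a theorem of intuitionistic propositional logic. -/
def IThm {α : Type} (F : PropForm α) : Prop := Deriv ∅ F

/-- `F` is a theorem of classical propositional logic
(intuitionistic logic plus double-negation elimination). -/
def CThm {α : Type} (F : PropForm α) : Prop :=
  Deriv {F | ∃ A, F = impl (neg (neg A)) A} F

/-- Conjunction of a finite list of formulas (empty conjunction is ⊤). -/
def bigConj {α : Type} : List (PropForm α) → PropForm α
  | [] => top
  | [A] => A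
  | A :: L => conj A (bigConj L)

/-- Disjunction of a finite list of formulas (empty disjunction is ⊥). -/
def bigDisj {α : Type} : List (PropForm α) → PropForm α
  | [] => fals
  | [A] => A
  | A :: L => disj A (bigDisj L)

/-- `T ⊢_X F`: the formula `F ← (F₁ ∧ ... ∧ Fₙ)` is a theorem of the logic
whose theorems are `Thm`, for some `F₁, ..., Fₙ ∈ T`. -/
def ProvesFrom {α : Type} (Thm : PropForm α → Prop) (T : Set (PropForm α))
    (F : PropForm α) : Prop :=
  ∃ L : List (PropForm α), (∀ G ∈ L, G ∈ T) ∧ Thm (impl (bigConj L) F)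

/-- `T ⊢_I F`. -/
def IProves {α : Type} (T : Set (PropForm α)) (F : PropForm α) : Prop :=
  ProvesFrom IThm T F

/-- `T ⊢_C F`. -/
def CProves {α : Type} (T : Set (PropForm α)) (F : PropForm α) : Prop :=
  ProvesFrom CThm T F

/-- `T` is consistent in intuitionistic logic. -/
def IConsistent {α : Type} (T : Set (PropForm α)) : Prop := ¬ IProves T fals

/-- `T ⊩_I M`: `T` is consistent and proves (intuitionistically) every atom of `M`. -/
def IProvesAll {α : Type} (T : Set (PropForm α)) (M : Set α) : Prop :=
  IConsistent T ∧ ∀ a ∈ M, IProves T (var a)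

/-- `T ≡_I U`: the two theories prove each other's formulas intuitionistically. -/
def IEquivTh {α : Type} (T U : Set (PropForm α)) : Prop :=
  (∀ F ∈ U, IProves T F) ∧ (∀ F ∈ T, IProves U F)

/-- The signature (set of occurring atoms) of a theory. -/
def sigTh {α : Type} (T : Set (PropForm α)) : Set α := ⋃ F ∈ T, F.atoms

/-- `T` is (literal) complete: for every atom `a` of its signature,
`T ⊢_I a` or `T ⊢_I ¬a`. -/
def IComplete {α : Type} (T : Set (PropForm α)) : Prop :=
  ∀ a ∈ sigTh T, IProves T (var a) ∨ IProves T (neg (var a))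

/-- `{¬a : a ∈ S}`. -/
def negSet {α : Type} (S : Set α) : Set (PropForm α) := (fun a => neg (var a)) '' S

/-- `{¬¬a : a ∈ S}`. -/
def negnegSet {α : Type} (S : Set α) : Set (PropForm α) :=
  (fun a => neg (neg (var a))) '' S

/-- Classical two-valued satisfaction, identifying an interpretation with the
set of atoms it makes true. -/
def sat2 {α : Type} (X : Set α) : PropForm α → Prop
  | .var a => a ∈ X
  | .fals => False
  | .conj A B => sat2 X A ∧ sat2 X B
  | .disj A B => sat2 X A ∨ sat2 X B
  | .impl A B => sat2 X A → sat2 X B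

/-- `X` is a classical model of the theory `T`. -/
def isModel2 {α : Type} (X : Set α) (T : Set (PropForm α)) : Prop := ∀ F ∈ T, sat2 X F

/-- `M` is a minimal (under ⊆) classical model of `T`. -/
def isMinModel {α : Type} (T : Set (PropForm α)) (M : Set α) : Prop :=
  isModel2 M T ∧ ∀ N ⊆ M, isModel2 N T → N = M

/-- Evaluation in the 3-valued Gödel logic G3. -/
def g3 {α : Type} (I : α → Fin 3) : PropForm α → Fin 3
  | .var a => I a
  | .fals => 0
  | .conj A B => min (g3 I A) (g3 I B)
  | .disj A B => max (g3 I A) (g3 I B)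
  | .impl A B => if g3 I A ≤ g3 I B then 2 else g3 I B

/-- Nested formulas: built from atoms, ⊤ and ⊥ using ∧, ∨ and ¬. -/
inductive NF (α : Type) : Type
  | var : α → NF α
  | top : NF α
  | bot : NF α
  | conj : NF α → NF α → NF α
  | disj : NF α → NF α → NF α
  | neg : NF α → NF α
  deriving DecidableEq

namespace NF

variable {α : Type}

/-- Reading a nested formula as a propositional formula
(`⊤ = ⊥ ← ⊥` and `¬F = ⊥ ← F`). -/
def toProp : NF α → PropForm α
  | var a => .var a
  | top => PropForm.top
  | bot => .fals
  | conj A B => .conj (toProp A) (toProp B)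
  | disj A B => .disj (toProp A) (toProp B)
  | neg A => PropForm.neg (toProp A)

/-- Atoms occurring in a nested formula. -/
def atoms : NF α → Set α
  | var a => {a}
  | top => ∅
  | bot => ∅
  | conj A B => atoms A ∪ atoms B
  | disj A B => atoms A ∪ atoms B
  | neg A => atoms A

/-- Satisfaction of a (basic, negation-free) nested formula by a set of atoms. -/
def satB (X : Set α) : NF α → Prop
  | var a => a ∈ X
  | top => True
  | bot => False
  | conj A B => satB X A ∧ satB X B
  | disj A B => satB X A ∨ satB X B
  | neg A => ¬ satB X A

open scoped Classical in
/-- The reduct `F^X`: each maximal subformula `¬G` is replaced by ⊥ if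
`X ⊨ G^X` and by ⊤ otherwise. -/
noncomputable def reduct (X : Set α) : NF α → NF α
  | var a => var a
  | top => top
  | bot => bot
  | conj A B => conj (reduct X A) (reduct X B)
  | disj A B => disj (reduct X A) (reduct X B)
  | neg A => if satB X (reduct X A) then bot else top

end NF

/-- An augmented clause `H ← B` is a pair `(H, B)` of nested formulas. -/
abbrev AugClause (α : Type) := NF α × NF α

/-- The propositional formula `H ← B` of an augmented clause. -/
def clauseToProp {α : Type} (c : AugClause α) : PropForm α :=
  .impl c.2.toProp c.1.toProp

/-- The theory of an augmented program. -/
def progTh {α : Type} (P : List (AugClause α)) : Set (PropForm α) :=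
  {F | ∃ c ∈ P, clauseToProp c = F}

/-- The signature of an augmented program. -/
def progSig {α : Type} (P : List (AugClause α)) : Set α :=
  {a | ∃ c ∈ P, a ∈ c.1.atoms ∪ c.2.atoms}

/-- `X` is closed under the (basic) program `P`: for each clause `H ← B`,
`X ⊨ H` whenever `X ⊨ B`. -/
def closedUnder {α : Type} (X : Set α) (P : List (AugClause α)) : Prop :=
  ∀ c ∈ P, NF.satB X c.2 → NF.satB X c.1

/-- The reduct `P^X` of an augmented program. -/
noncomputable def progReduct {α : Type} (X : Set α) (P : List (AugClause α)) :
    List (AugClause α) :=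
  P.map fun c => (c.1.reduct X, c.2.reduct X)

/-- `M` is an answer set of `P`: `M` is minimal (under ⊆) among the sets of
atoms closed under the reduct `P^M`. -/
def isAnswerSet {α : Type} (P : List (AugClause α)) (M : Set α) : Prop :=
  closedUnder M (progReduct M P) ∧ ∀ N ⊆ M, closedUnder N (progReduct M P) → N = M

/-- `M` is a min-answer set of `P`: both an answer set and a minimal model. -/
def isMinAnswerSet {α : Type} (P : List (AugClause α)) (M : Set α) : Prop :=
  isAnswerSet P M ∧ isMinModel (progTh P) M

/-- A G3 interpretation models an augmented program. -/
def g3ModelsProg {α : Type} (I : α → Fin 3) (P : List (AugClause α)) : Prop :=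
  ∀ c ∈ P, g3 I (clauseToProp c) = 2

/-- A free clause: a list of head literals and a list of body literals,
a literal being an atom `(a, true)` or a negated atom `(a, false)`.
It denotes `h₁ ∨ ... ∨ hₙ ← b₁ ∧ ... ∧ bₘ` (empty head = ⊥, empty body = ⊤). -/
structure FClause (α : Type) where
  head : List (α × Bool)
  body : List (α × Bool)
  deriving DecidableEq

/-- The propositional formula of a literal. -/
def litToProp {α : Type} : α × Bool → PropForm α
  | (a, true) => .var a
  | (a, false) => PropForm.neg (.var a)

/-- The nested formula of a literal. -/
def litToNF {α : Type} : α × Bool → NF α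
  | (a, true) => .var a
  | (a, false) => .neg (.var a)

/-- Disjunction of a list of nested formulas (empty = ⊥). -/
def bigDisjNF {α : Type} : List (NF α) → NF α
  | [] => .bot
  | [A] => A
  | A :: L => .disj A (bigDisjNF L)

/-- Conjunction of a list of nested formulas (empty = ⊤). -/
def bigConjNF {α : Type} : List (NF α) → NF α
  | [] => .top
  | [A] => A
  | A :: L => .conj A (bigConjNF L)

namespace FClause

variable {α : Type}

/-- The propositional formula of a free clause. -/
def toProp (c : FClause α) : PropForm α :=
  .impl (bigConj (c.body.map litToProp)) (bigDisj (c.head.map litToProp))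

/-- A free clause as an augmented clause. -/
def toAug (c : FClause α) : AugClause α :=
  (bigDisjNF (c.head.map litToNF), bigConjNF (c.body.map litToNF))

/-- The atoms of a free clause. -/
def atomsF (c : FClause α) : Set α :=
  {a | (∃ b, (a, b) ∈ c.head) ∨ (∃ b, (a, b) ∈ c.body)}

/-- A general clause: all head literals are positive atoms. -/
def isGeneral (c : FClause α) : Prop := ∀ l ∈ c.head, l.2 = true

/-- A disjunctive clause: a general clause with nonempty head. -/
def isDisjunctive (c : FClause α) : Prop := c.isGeneral ∧ c.head ≠ []

/-- A constraint: a clause with empty head (head ⊥). -/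
def isConstraint (c : FClause α) : Prop := c.head = []

end FClause

/-- The theory of a free program. -/
def fTh {α : Type} (P : List (FClause α)) : Set (PropForm α) :=
  {F | ∃ c ∈ P, c.toProp = F}

/-- The signature of a free program. -/
def fSig {α : Type} (P : List (FClause α)) : Set α :=
  {a | ∃ c ∈ P, a ∈ c.atomsF}

/-- `GenDisj(P)`: each constraint `⊥ ← B` is replaced by `p ← B ∧ ¬p`,
where `p` is a new reserved atom. -/
def genDisj {α : Type} [DecidableEq α] (P : List (FClause α)) (p : α) :
    List (FClause α) :=
  P.map fun c =>
    if c.head = [] then ⟨[(p, true)], c.body ++ [(p, false)]⟩ else c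

/-- The atoms `a` such that `¬a` occurs in the head of some clause of `P`
(the set `S` of the FreeGen transformation), as a list. -/
def headNegs {α : Type} (P : List (FClause α)) : List α :=
  P.flatMap fun c => c.head.filterMap fun l => if l.2 = false then some l.1 else none

open scoped Classical in
/-- Replace the occurrence of `¬a` (for `a ∈ S`) by the positive atom `φ a`. -/
noncomputable def substLit {α : Type} (S : Set α) (φ : α → α) (l : α × Bool) :
    α × Bool :=
  if l.2 = false ∧ l.1 ∈ S then (φ l.1, true) else l

/-- Replace every occurrence of `¬a` (for `a ∈ S`) by `φ a` in a clause. -/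
noncomputable def FClause.subst {α : Type} (S : Set α) (φ : α → α) (c : FClause α) :
    FClause α :=
  ⟨c.head.map (substLit S φ), c.body.map (substLit S φ)⟩

/-- `Δ_S = ⋃_{a ∈ S} {φ(a) ← ¬a, ⊥ ← a ∧ φ(a)}`. -/
def deltaClauses {α : Type} (L : List α) (φ : α → α) : List (FClause α) :=
  L.flatMap fun a => [⟨[(φ a, true)], [(a, false)]⟩, ⟨[], [(a, true), (φ a, true)]⟩]

/-- `FreeGen(P) = P' ∪ Δ_S`. -/
noncomputable def freeGen {α : Type} (P : List (FClause α)) (φ : α → α) :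
    List (FClause α) :=
  P.map (FClause.subst {a | a ∈ headNegs P} φ) ++ deltaClauses (headNegs P) φ

open scoped Classical in
/-- The second reduction `redu2(P; ¬¬M)`: clauses whose body contains a literal
`¬a` with `a ∈ M` are deleted; in constraints, positive body literals `a ∈ M`
are deleted. -/
noncomputable def redu2 {α : Type} [DecidableEq α] (P : List (FClause α))
    (M : Set α) : List (FClause α) :=
  (P.filter fun c => decide (¬ ∃ l ∈ c.body, l.2 = false ∧ l.1 ∈ M)).map
    fun c =>
      if c.head = [] then
        ⟨[], c.body.filter fun l => decide (¬ (l.2 = true ∧ l.1 ∈ M))⟩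
      else c

/-- `P₂` is a conservative extension of `P₁`: `M₁` is an answer set of `P₁`
iff `M₂` is an answer set of `P₂`, where `M₁ = M₂ ∩ σ_{P₁}`. -/
def consExt {α : Type} (P1 P2 : List (AugClause α)) : Prop :=
  (∀ M2 : Set α, isAnswerSet P2 M2 → isAnswerSet P1 (M2 ∩ progSig P1)) ∧
  (∀ M1 : Set α, isAnswerSet P1 M1 →
    ∃ M2 : Set α, isAnswerSet P2 M2 ∧ M1 = M2 ∩ progSig P1)

/-- `P₂` is a strong conservative extension of the user program `P₁` (relative
to the user signature `U`): for every user program `P`, `P₂ ∪ P` is a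
conservative extension of `P₁ ∪ P`. -/
def strongConsExt {α : Type} (P1 P2 : List (AugClause α)) (U : Set α) : Prop :=
  ∀ P : List (AugClause α), progSig P ⊆ U → consExt (P1 ++ P) (P2 ++ P)

mutual
  /-- Negation normal form: push negations inward (no pending negation). -/
  def nnf0 {α : Type} : NF α → NF α
    | .var a => .var a
    | .top => .top
    | .bot => .bot
    | .conj A B => .conj (nnf0 A) (nnf0 B)
    | .disj A B => .disj (nnf0 A) (nnf0 B)
    | .neg A => nnf1 A
  /-- Negation normal form under one pending negation. -/
  def nnf1 {α : Type} : NF α → NF α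
    | .var a => .neg (.var a)
    | .top => .bot
    | .bot => .top
    | .conj A B => .disj (nnf1 A) (nnf1 B)
    | .disj A B => .conj (nnf1 A) (nnf1 B)
    | .neg A => nnf2 A
  /-- Negation normal form under two pending negations. -/
  def nnf2 {α : Type} : NF α → NF α
    | .var a => .neg (.neg (.var a))
    | .top => .top
    | .bot => .bot
    | .conj A B => .conj (nnf2 A) (nnf2 B)
    | .disj A B => .disj (nnf2 A) (nnf2 B)
    | .neg A => nnf1 A
end

/-- Conjunctive normal form (list of disjunction-lists of leaves). -/
def cnfNF {α : Type} : NF α → List (List (NF α))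
  | .conj A B => cnfNF A ++ cnfNF B
  | .disj A B => (cnfNF A).flatMap fun c => (cnfNF B).map fun d => c ++ d
  | F => [[F]]

/-- Disjunctive normal form (list of conjunction-lists of leaves). -/
def dnfNF {α : Type} : NF α → List (List (NF α))
  | .disj A B => dnfNF A ++ dnfNF B
  | .conj A B => (dnfNF A).flatMap fun c => (dnfNF B).map fun d => c ++ d
  | F => [[F]]

/-- Read a leaf as a literal (if it is one). -/
def leafLit {α : Type} : NF α → Option (α × Bool)
  | .var a => some (a, true)
  | .neg (.var a) => some (a, false)
  | _ => none

/-- Read a leaf `¬¬a` as the literal `¬a` to be moved to the other side. -/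
def dnegLit {α : Type} : NF α → Option (α × Bool)
  | .neg (.neg (.var a)) => some (a, false)
  | _ => none

/-- Build a free clause from a head disjunct-list and a body conjunct-list:
doubly negated atoms `¬¬a` in the head become `¬a` in the body and vice versa;
trivial clauses (⊤ in the head or ⊥ in the body) are removed. -/
def procClause {α : Type} [DecidableEq α] (hd bd : List (NF α)) :
    Option (FClause α) :=
  if NF.top ∈ hd ∨ NF.bot ∈ bd then none
  else some ⟨hd.filterMap leafLit ++ bd.filterMap dnegLit,
             bd.filterMap leafLit ++ hd.filterMap dnegLit⟩

/-- `AugFree(P)`: the free program obtained from the augmented program `P` by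
pushing negations inward, taking CNF of heads and DNF of bodies, splitting
conjunctions in heads and disjunctions in bodies into separate clauses, and
eliminating doubly negated atoms. -/
def augFree {α : Type} [DecidableEq α] (P : List (AugClause α)) :
    List (FClause α) :=
  P.flatMap fun c =>
    (cnfNF (nnf0 c.1)).flatMap fun hd =>
      (dnfNF (nnf0 c.2)).filterMap fun bd => procClause hd bd

/-- Positive formulas: no negation (in particular no ⊥) occurs. -/
def IsPositive {α : Type} : PropForm α → Prop
  | .var _ => True
  | .fals => False
  | .conj A B => IsPositive A ∧ IsPositive B
  | .disj A B => IsPositive A ∧ IsPositive B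
  | .impl A B => IsPositive A ∧ IsPositive B

/-- The set 𝐍 of two-negated formulas. -/
inductive IsTwoNeg {α : Type} : PropForm α → Prop
  | atom (a : α) : IsTwoNeg (neg (neg (var a)))
  | dneg {A} : IsTwoNeg A → IsTwoNeg (neg (neg A))
  | conj {A B} : IsTwoNeg A → IsTwoNeg B → IsTwoNeg (PropForm.conj A B)
  | disjL {A} (B) : IsTwoNeg A → IsTwoNeg (PropForm.disj A B)
  | disjR {A} (B) : IsTwoNeg A → IsTwoNeg (PropForm.disj B A)
  | himp {A} (B) : IsTwoNeg A → IsTwoNeg (PropForm.impl B A)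

/-- Simultaneous substitution of formulas for atoms. -/
def PropForm.subst {α β : Type} (σ : α → PropForm β) : PropForm α → PropForm β
  | var a => σ a
  | fals => fals
  | conj A B => conj (A.subst σ) (B.subst σ)
  | disj A B => disj (A.subst σ) (B.subst σ)
  | impl A B => impl (A.subst σ) (B.subst σ)

theorem PropForm.subst_eq_self {α : Type} {σ : α → PropForm α} {A : PropForm α}
    (h : ∀ a ∈ A.atoms, σ a = var a) : A.subst σ = A := by
  induction A with
  | var a => exact h a rfl
  | fals => rfl
  | conj A B ihA ihB | disj A B ihA ihB | impl A B ihA ihB =>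
    simp only [subst]
    rw [ihA fun a ha => h a (Or.inl ha), ihB fun a ha => h a (Or.inr ha)]

theorem Deriv.subst {α β : Type} {Ax : Set (PropForm α)} (σ : α → PropForm β)
    {A : PropForm α} (h : Deriv Ax A) : Deriv (PropForm.subst σ '' Ax) (A.subst σ) := by
  induction h with
  | ax hA => exact .ax (Set.mem_image_of_mem _ hA)
  | k A B => exact .k _ _
  | s A B C => exact .s _ _ _
  | conjIntro A B => exact .conjIntro _ _
  | conjElimL A B => exact .conjElimL _ _
  | conjElimR A B => exact .conjElimR _ _
  | disjIntroL A B => exact .disjIntroL _ _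
  | disjIntroR A B => exact .disjIntroR _ _
  | disjElim A B C => exact .disjElim _ _ _
  | falsElim A => exact .falsElim _
  | mp _ _ ihAB ihA => exact .mp ihAB ihA

theorem IThm.subst {α β : Type} (σ : α → PropForm β) {A : PropForm α} (h : IThm A) :
    IThm (A.subst σ) := by
  simpa [IThm] using Deriv.subst σ h

namespace Deriv

variable {α : Type} {Ax : Set (PropForm α)} {A B C : PropForm α}

theorem weaken (h : Deriv Ax B) : Deriv Ax (impl A B) :=
  .mp (.k _ _) h

theorem impl_refl (A : PropForm α) : Deriv Ax (impl A A) :=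
  .mp (.mp (.s A (impl A A) A) (.k _ _)) (.k _ _)

theorem impl_mp (hBC : Deriv Ax (impl A (impl B C))) (hB : Deriv Ax (impl A B)) :
    Deriv Ax (impl A C) :=
  .mp (.mp (.s _ _ _) hBC) hB

theorem impl_trans (hAB : Deriv Ax (impl A B)) (hBC : Deriv Ax (impl B C)) :
    Deriv Ax (impl A C) :=
  impl_mp (weaken hBC) hAB

theorem impl_conj (hB : Deriv Ax (impl A B)) (hC : Deriv Ax (impl A C)) :
    Deriv Ax (impl A (conj B C)) :=
  impl_mp (impl_trans hB (.conjIntro _ _)) hC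

theorem bigConj_elim {L : List (PropForm α)} (hA : A ∈ L) :
    Deriv Ax (impl (bigConj L) A) := by
  induction L with
  | nil => simp at hA
  | cons B L ih =>
    cases L with
    | nil =>
      obtain rfl : A = B := by simpa using hA
      exact impl_refl _
    | cons C L =>
      rcases List.mem_cons.1 hA with rfl | hA
      · exact .conjElimL _ _
      · exact impl_trans (.conjElimR _ _) (ih hA)

theorem impl_bigConj {L : List (PropForm α)} (h : ∀ B ∈ L, Deriv Ax (impl A B)) :
    Deriv Ax (impl A (bigConj L)) := by
  induction L with
  | nil => exact weaken (impl_refl _)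
  | cons B L ih =>
    cases L with
    | nil => exact h B (by simp)
    | cons C L =>
      exact impl_conj (h B (by simp)) (ih fun D hD => h D (List.mem_cons_of_mem _ hD))

end Deriv

theorem subst_bigConj {α β : Type} (σ : α → PropForm β) (L : List (PropForm α)) :
    (bigConj L).subst σ = bigConj (L.map (PropForm.subst σ)) := by
  induction L with
  | nil => rfl
  | cons B L ih =>
    cases L with
    | nil => rfl
    | cons C L => exact congrArg (conj (B.subst σ)) ih

theorem atoms_subset_sigTh {α : Type} {T : Set (PropForm α)} {F : PropForm α} (hF : F ∈ T) :
    F.atoms ⊆ sigTh T :=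
  Set.subset_biUnion_of_mem (u := PropForm.atoms) hF

/-- if `σ_{T1 ∪ {A}} ∩ σ_{T2} = ∅` and `T2` is a set of negative
literals, then `T1 ∪ T2 ⊢_I A` implies `T1 ⊢_I A`. -/
theorem remove_disjoint_negative_literals {α : Type} (T1 T2 : Set (PropForm α))
    (A : PropForm α) (hfin1 : T1.Finite) (hfin2 : T2.Finite)
    (hdisj : sigTh (T1 ∪ {A}) ∩ sigTh T2 = ∅)
    (hneg : ∀ F ∈ T2, ∃ a : α, F = PropForm.neg (PropForm.var a))
    (h : IProves (T1 ∪ T2) A) : IProves T1 A := by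
  classical
  obtain ⟨L, hL, hLA⟩ := h
  let σ : α → PropForm α := fun a => if a ∈ sigTh T2 then fals else var a
  have hfix : ∀ F ∈ T1 ∪ {A}, F.subst σ = F := fun F hF =>
    subst_eq_self fun a ha => if_neg fun ha2 =>
      (hdisj ▸ ⟨atoms_subset_sigTh hF ha, ha2⟩ : a ∈ (∅ : Set α))
  refine ⟨L.filter (· ∈ T1), fun G hG => by simpa using (List.mem_filter.1 hG).2, ?_⟩
  have hLA' := hLA.subst σ
  simp only [PropForm.subst, subst_bigConj, hfix A (Or.inr rfl)] at hLA'
  refine Deriv.impl_trans (Deriv.impl_bigConj fun B hB => ?_) hLA'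
  obtain ⟨G, hGL, rfl⟩ := List.mem_map.1 hB
  rcases hL G hGL with hG | hG
  · rw [hfix G (Or.inl hG)]
    exact Deriv.bigConj_elim (List.mem_filter.2 ⟨hGL, by simpa using hG⟩)
  · obtain ⟨a, rfl⟩ := hneg G hG
    have ha : a ∈ sigTh T2 := atoms_subset_sigTh hG (Or.inl rfl)
    simp only [neg, PropForm.subst, σ, if_pos ha]
    exact Deriv.weaken (Deriv.impl_refl _)

end ASP
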